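/- arXiv:1205.3562 — 3 statements merged into one kernel-verified Lean document; each statement's English description precedes it below -/
import Mathlib

section
/- The cross products of the coordinate vector fields of a patch and of its inverse patch are related by y_u × y_v = λ² ( −(x_u × x_v) + (2⟨x − c, x_u × x_v⟩/‖x − c‖²)(x − c) ) at every point (u,v). -/
noncomputable section
open scoped RealInnerProductSpace

/-- ℝ³ as Euclidean 3-space. -/
abbrev E3 : Type := EuclideanSpace ℝ (Fin 3)

/-- The cross product on ℝ³. -/
def cross (a b : E3) : E3 :=
  (WithLp.equiv 2 (Fin 3 → ℝ)).symm
    ![a 1 * b 2 - a 2 * b 1, a 2 * b 0 - a 0 * b 2, a 0 * b 1 - a 1 * b 0]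

/-- The inversion of ℝ³ with center `c` and radius `r`. -/
def inv3 (c : E3) (r : ℝ) (p : E3) : E3 :=
  c + (r ^ 2 / ‖p - c‖ ^ 2) • (p - c)

/-- Partial derivative in the first variable. -/
def pu {E : Type*} [NormedAddCommGroup E] [NormedSpace ℝ E]
    (x : ℝ → ℝ → E) (u v : ℝ) : E :=
  deriv (fun t => x t v) u

/-- Partial derivative in the second variable. -/
def pv {E : Type*} [NormedAddCommGroup E] [NormedSpace ℝ E]
    (x : ℝ → ℝ → E) (u v : ℝ) : E :=
  deriv (fun t => x u t) v

/-- The unit normal of a patch. -/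
def unormal (x : ℝ → ℝ → E3) (u v : ℝ) : E3 :=
  ‖cross (pu x u v) (pv x u v)‖⁻¹ • cross (pu x u v) (pv x u v)

/-- The conformal factor λ of the inversion along the patch. -/
def lam (c : E3) (r : ℝ) (x : ℝ → ℝ → E3) (u v : ℝ) : ℝ :=
  r ^ 2 / ‖x u v - c‖ ^ 2

/-- The support-type function η = ⟨U_x, x − c⟩. -/
def eta (c : E3) (x : ℝ → ℝ → E3) (u v : ℝ) : ℝ :=
  ⟪unormal x u v, x u v - c⟫

/-- First fundamental form coefficient E. -/
def FFE (x : ℝ → ℝ → E3) (u v : ℝ) : ℝ := ⟪pu x u v, pu x u v⟫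
/-- First fundamental form coefficient F. -/
def FFF (x : ℝ → ℝ → E3) (u v : ℝ) : ℝ := ⟪pu x u v, pv x u v⟫
/-- First fundamental form coefficient G. -/
def FFG (x : ℝ → ℝ → E3) (u v : ℝ) : ℝ := ⟪pv x u v, pv x u v⟫
/-- Second fundamental form coefficient e. -/
def SFe (x : ℝ → ℝ → E3) (u v : ℝ) : ℝ := ⟪pu (pu x) u v, unormal x u v⟫
/-- Second fundamental form coefficient f. -/
def SFf (x : ℝ → ℝ → E3) (u v : ℝ) : ℝ := ⟪pv (pu x) u v, unormal x u v⟫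
/-- Second fundamental form coefficient g. -/
def SFg (x : ℝ → ℝ → E3) (u v : ℝ) : ℝ := ⟪pv (pv x) u v, unormal x u v⟫
/-- Third fundamental form coefficient P. -/
def TFP (x : ℝ → ℝ → E3) (u v : ℝ) : ℝ := ⟪pu (unormal x) u v, pu (unormal x) u v⟫
/-- Third fundamental form coefficient Q. -/
def TFQ (x : ℝ → ℝ → E3) (u v : ℝ) : ℝ := ⟪pu (unormal x) u v, pv (unormal x) u v⟫
/-- Third fundamental form coefficient R. -/
def TFR (x : ℝ → ℝ → E3) (u v : ℝ) : ℝ := ⟪pv (unormal x) u v, pv (unormal x) u v⟫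

/-- Christoffel symbol Γ¹₁₁. -/
def Ch111 (x : ℝ → ℝ → E3) (u v : ℝ) : ℝ :=
  (FFG x u v * pu (FFE x) u v - 2 * FFF x u v * pu (FFF x) u v + FFF x u v * pv (FFE x) u v) /
    (2 * (FFE x u v * FFG x u v - FFF x u v ^ 2))
/-- Christoffel symbol Γ²₁₁. -/
def Ch211 (x : ℝ → ℝ → E3) (u v : ℝ) : ℝ :=
  (2 * FFE x u v * pu (FFF x) u v - FFE x u v * pv (FFE x) u v - FFF x u v * pu (FFE x) u v) /
    (2 * (FFE x u v * FFG x u v - FFF x u v ^ 2))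
/-- Christoffel symbol Γ¹₁₂. -/
def Ch112 (x : ℝ → ℝ → E3) (u v : ℝ) : ℝ :=
  (FFG x u v * pv (FFE x) u v - FFF x u v * pu (FFG x) u v) /
    (2 * (FFE x u v * FFG x u v - FFF x u v ^ 2))
/-- Christoffel symbol Γ²₁₂. -/
def Ch212 (x : ℝ → ℝ → E3) (u v : ℝ) : ℝ :=
  (FFE x u v * pu (FFG x) u v - FFF x u v * pv (FFE x) u v) /
    (2 * (FFE x u v * FFG x u v - FFF x u v ^ 2))
/-- Christoffel symbol Γ¹₂₂. -/
def Ch122 (x : ℝ → ℝ → E3) (u v : ℝ) : ℝ :=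
  (2 * FFG x u v * pv (FFF x) u v - FFG x u v * pu (FFG x) u v - FFF x u v * pv (FFG x) u v) /
    (2 * (FFE x u v * FFG x u v - FFF x u v ^ 2))
/-- Christoffel symbol Γ²₂₂. -/
def Ch222 (x : ℝ → ℝ → E3) (u v : ℝ) : ℝ :=
  (FFE x u v * pv (FFG x) u v - 2 * FFF x u v * pv (FFF x) u v + FFF x u v * pu (FFG x) u v) /
    (2 * (FFE x u v * FFG x u v - FFF x u v ^ 2))

/-- The tangent map of the inversion at `p`. -/
def phiStar (c : E3) (r : ℝ) (p : E3) (w : E3) : E3 :=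
  (r ^ 2 / ‖p - c‖ ^ 2) • w - (2 * r ^ 2 * ⟪p - c, w⟫ / ‖p - c‖ ^ 4) • (p - c)

theorem hasDerivAt_inv3 {c : E3} {r : ℝ} {f : ℝ → E3} {f' : E3} {t : ℝ}
    (hf : HasDerivAt f f' t) (hc : f t ≠ c) :
    HasDerivAt (fun s => inv3 c r (f s)) (phiStar c r (f t) f') t := by
  have hd := hf.sub_const c
  have hN : ‖f t - c‖ ≠ 0 := norm_ne_zero_iff.mpr (sub_ne_zero.mpr hc)
  have h := ((((hasDerivAt_const t (r ^ 2)).fun_div hd.norm_sq (pow_ne_zero 2 hN)).fun_smul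
    hd).const_add c)
  refine h.congr_deriv ?_
  rw [phiStar, sub_eq_add_neg (_ • f'), ← neg_smul]
  congr 2
  ring

theorem cross_phiStar {c p : E3} (r : ℝ) (hp : p ≠ c) (a b : E3) :
    cross (phiStar c r p a) (phiStar c r p b) =
      (r ^ 2 / ‖p - c‖ ^ 2) ^ 2 •
        (-(cross a b) + (2 * ⟪p - c, cross a b⟫ / ‖p - c‖ ^ 2) • (p - c)) := by
  have hN : ‖p - c‖ ^ 2 ≠ 0 := pow_ne_zero 2 (norm_ne_zero_iff.mpr (sub_ne_zero.mpr hp))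
  have h4 : ‖p - c‖ ^ 4 = (‖p - c‖ ^ 2) ^ 2 := by ring
  simp only [phiStar, h4]
  generalize p - c = d at *
  rw [EuclideanSpace.real_norm_sq_eq, Fin.sum_univ_three] at *
  ext i
  fin_cases i <;>
  · simp [cross, PiLp.inner_apply, Fin.sum_univ_three]
    field_simp
    ring

theorem inverse_patch_cross_product
    (c : E3) (r : ℝ) (hr : 0 < r)
    (x : ℝ → ℝ → E3)
    (hx : ContDiff ℝ (⊤ : ℕ∞) (fun p : ℝ × ℝ => x p.1 p.2))
    (hxc : ∀ u v : ℝ, x u v ≠ c)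
    (y : ℝ → ℝ → E3) (hy : ∀ u v : ℝ, y u v = inv3 c r (x u v)) :
    ∀ u v : ℝ,
      cross (pu y u v) (pv y u v) =
        (lam c r x u v) ^ 2 •
          (-(cross (pu x u v) (pv x u v)) +
            (2 * ⟪x u v - c, cross (pu x u v) (pv x u v)⟫ / ‖x u v - c‖ ^ 2) •
              (x u v - c)) := by
  intro u v
  have hdiff : Differentiable ℝ (fun p : ℝ × ℝ => x p.1 p.2) := hx.differentiable (by simp)
  have hu : DifferentiableAt ℝ (fun t => x t v) u :=
    (hdiff (u, v)).comp u (f := fun t : ℝ => (t, v)) (by fun_prop)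
  have hv : DifferentiableAt ℝ (fun t => x u t) v :=
    (hdiff (u, v)).comp v (f := fun t : ℝ => (u, t)) (by fun_prop)
  have hyu : pu y u v = phiStar c r (x u v) (pu x u v) := by
    simp only [pu, hy]
    exact (hasDerivAt_inv3 hu.hasDerivAt (hxc u v)).deriv
  have hyv : pv y u v = phiStar c r (x u v) (pv x u v) := by
    simp only [pv, hy]
    exact (hasDerivAt_inv3 hv.hasDerivAt (hxc u v)).deriv
  rw [hyu, hyv, lam, cross_phiStar r (hxc u v)]
end
end

section
/- At every point (u,v), the norm of the cross product of the coordinate vector fields of the inverse patch satisfies ‖y_u × y_v‖ = λ² ‖x_u × x_v‖. -/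
noncomputable section
open scoped RealInnerProductSpace

/-- Lagrange's identity for the cross product. -/
theorem norm_cross_sq (a b : E3) :
    ‖cross a b‖ ^ 2 = ‖a‖ ^ 2 * ‖b‖ ^ 2 - ⟪a, b⟫ ^ 2 := by
  simp only [EuclideanSpace.real_norm_sq_eq, PiLp.inner_apply, Fin.sum_univ_three, cross]
  simp
  ring

/-- A linear isometry scaled by `k` scales the norm of cross products by `k ^ 2`. -/
theorem norm_cross_smul_isometry (k : ℝ) (f : E3 →ₗᵢ[ℝ] E3) (a b : E3) :
    ‖cross (k • f a) (k • f b)‖ = k ^ 2 * ‖cross a b‖ := by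
  rw [← sq_eq_sq₀ (norm_nonneg _) (by positivity), mul_pow, norm_cross_sq, norm_cross_sq]
  simp only [norm_smul, real_inner_smul_left, real_inner_smul_right, f.norm_map, f.inner_map_map,
    mul_pow, Real.norm_eq_abs, sq_abs]
  ring

theorem inv3_eq_inversion (c : E3) (r : ℝ) : inv3 c r = EuclideanGeometry.inversion c r := by
  ext1 p
  simp [inv3, EuclideanGeometry.inversion, dist_eq_norm, div_pow, add_comm]

/-- The derivative of the inverse of a curve is a scaled reflection of its velocity. -/
theorem deriv_inv3_comp {c : E3} (r : ℝ) {γ : ℝ → E3} {t : ℝ}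
    (hγ : DifferentiableAt ℝ γ t) (hc : γ t ≠ c) :
    deriv (fun s => inv3 c r (γ s)) t =
      (r ^ 2 / ‖γ t - c‖ ^ 2) • (ℝ ∙ (γ t - c))ᗮ.reflection (deriv γ t) := by
  rw [inv3_eq_inversion]
  have h := (EuclideanGeometry.hasFDerivAt_inversion (R := r) hc).comp_hasDerivAt t hγ.hasDerivAt
  rw [← div_pow, ← dist_eq_norm]
  exact h.deriv

theorem inverse_patch_cross_product_norm
    (c : E3) (r : ℝ) (hr : 0 < r)
    (x : ℝ → ℝ → E3)
    (hx : ContDiff ℝ (⊤ : ℕ∞) (fun p : ℝ × ℝ => x p.1 p.2))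
    (hxc : ∀ u v : ℝ, x u v ≠ c)
    (y : ℝ → ℝ → E3) (hy : ∀ u v : ℝ, y u v = inv3 c r (x u v)) :
    ∀ u v : ℝ,
      ‖cross (pu y u v) (pv y u v)‖ = (lam c r x u v) ^ 2 * ‖cross (pu x u v) (pv x u v)‖ := by
  intro u v
  have hd : Differentiable ℝ (fun p : ℝ × ℝ => x p.1 p.2) := hx.differentiable (by simp)
  have hu : DifferentiableAt ℝ (fun t => x t v) u :=
    (hd (u, v)).comp (f := fun t : ℝ => (t, v)) u (by fun_prop)
  have hv : DifferentiableAt ℝ (fun t => x u t) v :=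
    (hd (u, v)).comp (f := fun t : ℝ => (u, t)) v (by fun_prop)
  simp only [pu, pv, hy, lam]
  rw [deriv_inv3_comp r hu (hxc u v), deriv_inv3_comp r hv (hxc u v)]
  exact norm_cross_smul_isometry _ (ℝ ∙ (x u v - c))ᗮ.reflection.toLinearIsometry _ _
end
end

section
/- (Corollary 3.2) The Christoffel symbols of a patch and of its inverse patch are related by: Γ̃¹₁₁ = Γ¹₁₁ + [(EG − 2F²)(λ²)_u + FE(λ²)_v]/(2λ²(EG − F²)), Γ̃²₁₁ = Γ²₁₁ + [EF(λ²)_u − E²(λ²)_v]/(2λ²(EG − F²)), Γ̃¹₁₂ = Γ¹₁₂ + [GE(λ²)_v − GF(λ²)_u]/(2λ²(EG − F²)), Γ̃²₁₂ = Γ²₁₂ + [EG(λ²)_u − EF(λ²)_v]/(2λ²(EG − F²)), Γ̃¹₂₂ = Γ¹₂₂ + [GF(λ²)_v − G²(λ²)_u]/(2λ²(EG − F²)), and Γ̃²₂₂ = Γ²₂₂ + [(EG − 2F²)(λ²)_v + FG(λ²)_u]/(2λ²(EG − F²)). -/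
noncomputable section
open scoped RealInnerProductSpace

theorem HasDerivAt.inv3 {c : E3} {r : ℝ} {g : ℝ → E3} {g' : E3} {t : ℝ}
    (hg : HasDerivAt g g' t) (hgc : g t ≠ c) :
    HasDerivAt (fun s => inv3 c r (g s)) (phiStar c r (g t) g') t := by
  have hn : ‖g t - c‖ ≠ 0 := norm_ne_zero_iff.mpr (sub_ne_zero.mpr hgc)
  have hd : HasDerivAt (fun s => g s - c) g' t := hg.sub_const c
  have hl := (hasDerivAt_const t (r ^ 2)).fun_div hd.norm_sq (pow_ne_zero 2 hn)
  have h := (hl.fun_smul hd).const_add c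
  refine h.congr_deriv ?_
  rw [phiStar, sub_eq_add_neg (_ • g'), ← neg_smul]
  congr 2
  field_simp
  ring

theorem inner_phiStar {c p : E3} (r : ℝ) (hp : p ≠ c) (a b : E3) :
    ⟪phiStar c r p a, phiStar c r p b⟫ = (r ^ 2 / ‖p - c‖ ^ 2) ^ 2 * ⟪a, b⟫ := by
  have hn : ‖p - c‖ ≠ 0 := norm_ne_zero_iff.mpr (sub_ne_zero.mpr hp)
  unfold phiStar
  generalize p - c = d at hn ⊢
  simp only [inner_sub_left, inner_sub_right, real_inner_smul_left, real_inner_smul_right,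
    real_inner_self_eq_norm_sq, real_inner_comm d a]
  field_simp
  ring

section PartialDerivatives

variable {E : Type*} [NormedAddCommGroup E] [NormedSpace ℝ E]

theorem hasDerivAt_pu {f : ℝ → ℝ → E} (hf : Differentiable ℝ (fun p : ℝ × ℝ => f p.1 p.2))
    (u v : ℝ) : HasDerivAt (fun t => f t v) (pu f u v) u :=
  ((hf (u, v)).comp (f := fun t : ℝ => (t, v)) u (by fun_prop)).hasDerivAt

theorem hasDerivAt_pv {f : ℝ → ℝ → E} (hf : Differentiable ℝ (fun p : ℝ × ℝ => f p.1 p.2))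
    (u v : ℝ) : HasDerivAt (fun t => f u t) (pv f u v) v :=
  ((hf (u, v)).comp (f := fun t : ℝ => (u, t)) v (by fun_prop)).hasDerivAt

theorem ContDiff.differentiable_pu {f : ℝ → ℝ → E}
    (hf : ContDiff ℝ 2 (fun p : ℝ × ℝ => f p.1 p.2)) :
    Differentiable ℝ (fun p : ℝ × ℝ => pu f p.1 p.2) := by
  have h : (fun p : ℝ × ℝ => pu f p.1 p.2) =
      fun p => fderiv ℝ (fun p : ℝ × ℝ => f p.1 p.2) p (1, 0) := by
    funext ⟨u, v⟩
    exact ((hf.differentiable two_ne_zero (u, v)).hasFDerivAt.comp_hasDerivAt u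
      ((hasDerivAt_id u).prodMk (hasDerivAt_const u v))).deriv
  rw [h]
  exact ((hf.fderiv_right (m := 1) (by norm_num)).differentiable one_ne_zero).clm_apply
    (differentiable_const _)

theorem ContDiff.differentiable_pv {f : ℝ → ℝ → E}
    (hf : ContDiff ℝ 2 (fun p : ℝ × ℝ => f p.1 p.2)) :
    Differentiable ℝ (fun p : ℝ × ℝ => pv f p.1 p.2) := by
  have h : (fun p : ℝ × ℝ => pv f p.1 p.2) =
      fun p => fderiv ℝ (fun p : ℝ × ℝ => f p.1 p.2) p (0, 1) := by
    funext ⟨u, v⟩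
    exact ((hf.differentiable two_ne_zero (u, v)).hasFDerivAt.comp_hasDerivAt v
      ((hasDerivAt_const v u).prodMk (hasDerivAt_id v))).deriv
  rw [h]
  exact ((hf.fderiv_right (m := 1) (by norm_num)).differentiable one_ne_zero).clm_apply
    (differentiable_const _)

theorem pu_mul {f g : ℝ → ℝ → ℝ} (hf : Differentiable ℝ (fun p : ℝ × ℝ => f p.1 p.2))
    (hg : Differentiable ℝ (fun p : ℝ × ℝ => g p.1 p.2)) (u v : ℝ) :
    pu (fun a b => f a b * g a b) u v = pu f u v * g u v + f u v * pu g u v :=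
  ((hasDerivAt_pu hf u v).fun_mul (hasDerivAt_pu hg u v)).deriv

theorem pv_mul {f g : ℝ → ℝ → ℝ} (hf : Differentiable ℝ (fun p : ℝ × ℝ => f p.1 p.2))
    (hg : Differentiable ℝ (fun p : ℝ × ℝ => g p.1 p.2)) (u v : ℝ) :
    pv (fun a b => f a b * g a b) u v = pv f u v * g u v + f u v * pv g u v :=
  ((hasDerivAt_pv hf u v).fun_mul (hasDerivAt_pv hg u v)).deriv

end PartialDerivatives

theorem differentiable_lam {c : E3} (r : ℝ) {x : ℝ → ℝ → E3}
    (hx : Differentiable ℝ (fun p : ℝ × ℝ => x p.1 p.2)) (hxc : ∀ u v : ℝ, x u v ≠ c) :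
    Differentiable ℝ (fun p : ℝ × ℝ => lam c r x p.1 p.2) := by
  have hsq : Differentiable ℝ (fun p : ℝ × ℝ => ‖x p.1 p.2 - c‖ ^ 2) :=
    (hx.sub_const c).norm_sq ℝ
  simp only [lam, div_eq_mul_inv]
  exact (hsq.fun_inv fun p => pow_ne_zero 2
    (norm_ne_zero_iff.mpr (sub_ne_zero.mpr (hxc p.1 p.2)))).const_mul (r ^ 2)

theorem inverse_patch_christoffel_symbols
    (c : E3) (r : ℝ) (hr : 0 < r)
    (x : ℝ → ℝ → E3)
    (hx : ContDiff ℝ (⊤ : ℕ∞) (fun p : ℝ × ℝ => x p.1 p.2))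
    (hxc : ∀ u v : ℝ, x u v ≠ c)
    (y : ℝ → ℝ → E3) (hy : ∀ u v : ℝ, y u v = inv3 c r (x u v))
    (hreg : ∀ u v : ℝ, cross (pu x u v) (pv x u v) ≠ 0)
    (hpos : ∀ u v : ℝ, 0 < FFE x u v * FFG x u v - FFF x u v ^ 2) :
    ∀ u v : ℝ,
      Ch111 y u v = Ch111 x u v +
        ((FFE x u v * FFG x u v - 2 * FFF x u v ^ 2) * pu (fun a b => lam c r x a b ^ 2) u v +
            FFF x u v * FFE x u v * pv (fun a b => lam c r x a b ^ 2) u v) /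
          (2 * lam c r x u v ^ 2 * (FFE x u v * FFG x u v - FFF x u v ^ 2)) ∧
      Ch211 y u v = Ch211 x u v +
        (FFE x u v * FFF x u v * pu (fun a b => lam c r x a b ^ 2) u v -
            FFE x u v ^ 2 * pv (fun a b => lam c r x a b ^ 2) u v) /
          (2 * lam c r x u v ^ 2 * (FFE x u v * FFG x u v - FFF x u v ^ 2)) ∧
      Ch112 y u v = Ch112 x u v +
        (FFG x u v * FFE x u v * pv (fun a b => lam c r x a b ^ 2) u v -
            FFG x u v * FFF x u v * pu (fun a b => lam c r x a b ^ 2) u v) /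
          (2 * lam c r x u v ^ 2 * (FFE x u v * FFG x u v - FFF x u v ^ 2)) ∧
      Ch212 y u v = Ch212 x u v +
        (FFE x u v * FFG x u v * pu (fun a b => lam c r x a b ^ 2) u v -
            FFE x u v * FFF x u v * pv (fun a b => lam c r x a b ^ 2) u v) /
          (2 * lam c r x u v ^ 2 * (FFE x u v * FFG x u v - FFF x u v ^ 2)) ∧
      Ch122 y u v = Ch122 x u v +
        (FFG x u v * FFF x u v * pv (fun a b => lam c r x a b ^ 2) u v -
            FFG x u v ^ 2 * pu (fun a b => lam c r x a b ^ 2) u v) /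
          (2 * lam c r x u v ^ 2 * (FFE x u v * FFG x u v - FFF x u v ^ 2)) ∧
      Ch222 y u v = Ch222 x u v +
        ((FFE x u v * FFG x u v - 2 * FFF x u v ^ 2) * pv (fun a b => lam c r x a b ^ 2) u v +
            FFF x u v * FFG x u v * pu (fun a b => lam c r x a b ^ 2) u v) /
          (2 * lam c r x u v ^ 2 * (FFE x u v * FFG x u v - FFF x u v ^ 2)) := by
  have hx2 : ContDiff ℝ 2 (fun p : ℝ × ℝ => x p.1 p.2) := contDiff_infty.mp hx 2
  have hxd := hx2.differentiable two_ne_zero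
  have hxu := hx2.differentiable_pu
  have hxv := hx2.differentiable_pv
  obtain rfl : y = fun u v => inv3 c r (x u v) := by
    funext u v
    exact hy u v
  have hyu (u v : ℝ) :
      pu (fun u v => inv3 c r (x u v)) u v = phiStar c r (x u v) (pu x u v) :=
    ((hasDerivAt_pu hxd u v).inv3 (hxc u v)).deriv
  have hyv (u v : ℝ) :
      pv (fun u v => inv3 c r (x u v)) u v = phiStar c r (x u v) (pv x u v) :=
    ((hasDerivAt_pv hxd u v).inv3 (hxc u v)).deriv
  have hE : FFE (fun u v => inv3 c r (x u v)) = fun a b => lam c r x a b ^ 2 * FFE x a b := by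
    funext a b
    simp only [FFE, lam, hyu, inner_phiStar r (hxc a b)]
  have hF : FFF (fun u v => inv3 c r (x u v)) = fun a b => lam c r x a b ^ 2 * FFF x a b := by
    funext a b
    simp only [FFF, lam, hyu, hyv, inner_phiStar r (hxc a b)]
  have hG : FFG (fun u v => inv3 c r (x u v)) = fun a b => lam c r x a b ^ 2 * FFG x a b := by
    funext a b
    simp only [FFG, lam, hyv, inner_phiStar r (hxc a b)]
  have hlam : Differentiable ℝ (fun p : ℝ × ℝ => lam c r x p.1 p.2 ^ 2) :=
    (differentiable_lam r hxd hxc).fun_pow 2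
  have hpu {g : ℝ → ℝ → ℝ} (hg : Differentiable ℝ (fun p : ℝ × ℝ => g p.1 p.2)) :=
    pu_mul (f := fun a b => lam c r x a b ^ 2) hlam hg
  have hpv {g : ℝ → ℝ → ℝ} (hg : Differentiable ℝ (fun p : ℝ × ℝ => g p.1 p.2)) :=
    pv_mul (f := fun a b => lam c r x a b ^ 2) hlam hg
  have hEd : Differentiable ℝ (fun p : ℝ × ℝ => FFE x p.1 p.2) := hxu.inner ℝ hxu
  have hFd : Differentiable ℝ (fun p : ℝ × ℝ => FFF x p.1 p.2) := hxu.inner ℝ hxv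
  have hGd : Differentiable ℝ (fun p : ℝ × ℝ => FFG x p.1 p.2) := hxv.inner ℝ hxv
  intro u v
  have hl : lam c r x u v ≠ 0 := div_ne_zero (pow_ne_zero 2 hr.ne')
    (pow_ne_zero 2 (norm_ne_zero_iff.mpr (sub_ne_zero.mpr (hxc u v))))
  have hW := (hpos u v).ne'
  simp only [Ch111, Ch211, Ch112, Ch212, Ch122, Ch222, hE, hF, hG, hpu hEd, hpu hFd,
    hpu hGd, hpv hEd, hpv hFd, hpv hGd]
  have hden : lam c r x u v ^ 2 * FFE x u v * (lam c r x u v ^ 2 * FFG x u v) -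
      (lam c r x u v ^ 2 * FFF x u v) ^ 2 =
      lam c r x u v ^ 4 * (FFE x u v * FFG x u v - FFF x u v ^ 2) := by ring
  rw [hden]
  generalize FFE x u v * FFG x u v - FFF x u v ^ 2 = W at hW
  refine ⟨?_, ?_, ?_, ?_, ?_, ?_⟩ <;> field_simp <;> ring
end
end
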